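/- arXiv:2001.04857 — 3 statements merged into one kernel-verified Lean document; each statement's English description precedes it below -/
import Mathlib

section
/- Let X be an infinite, connected, vertex-transitive, uniformly locally finite graph (its automorphism group acts transitively on vertices). If X has ℤ-large circuits, i.e., 𝒞_r(X,ℤ) ≠ 𝒞_∞(X,ℤ) for every r, then 𝒞_∞(X,ℤ) ≠ Z^suf_1(X,ℤ): there exists a bounded flow on X that does not belong to 𝒞_∞(X,ℤ). Equivalently, H^uf_1(X,ℤ) ≠ 0. -/
open scoped Classical

namespace UFH

variable {V : Type}

/-- Uniform local finiteness: a uniform bound on vertex degrees. -/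
def ULF (G : SimpleGraph V) : Prop :=
  ∃ D : ℕ, ∀ v : V, (G.neighborSet v).Finite ∧ (G.neighborSet v).ncard ≤ D

/-- An integer 1-chain: antisymmetric and supported on adjacent pairs. -/
def IsChain1 (G : SimpleGraph V) (f : V → V → ℤ) : Prop :=
  (∀ u v, f u v = - f v u) ∧ ∀ u v, f u v ≠ 0 → G.Adj u v

/-- A mod-2 1-chain: symmetric and supported on adjacent pairs. -/
def IsChain1Z2 (G : SimpleGraph V) (f : V → V → ZMod 2) : Prop :=
  (∀ u v, f u v = f v u) ∧ ∀ u v, f u v ≠ 0 → G.Adj u v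

/-- Divergence of an integer 1-chain at a vertex. -/
noncomputable def chainDiv (f : V → V → ℤ) (v : V) : ℤ := ∑ᶠ u, f u v

/-- Divergence of a mod-2 1-chain at a vertex. -/
noncomputable def chainDivZ2 (f : V → V → ZMod 2) (v : V) : ZMod 2 := ∑ᶠ u, f u v

def Bdd (f : V → V → ℤ) (C : ℕ) : Prop := ∀ u v, |f u v| ≤ (C : ℤ)

/-- The sup-norm of a bounded integer 1-chain (least uniform bound). -/
noncomputable def chainNorm (f : V → V → ℤ) : ℕ := sInf {C : ℕ | Bdd f C}

/-- Bounded integer flows: bounded 1-chains with vanishing divergence everywhere. -/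
def Zsuf1 (G : SimpleGraph V) : Set (V → V → ℤ) :=
  {f | IsChain1 G f ∧ (∃ C, Bdd f C) ∧ ∀ v, chainDiv f v = 0}

/-- Mod-2 cycles: mod-2 1-chains whose support meets every vertex evenly. -/
def Zsuf1Z2 (G : SimpleGraph V) : Set (V → V → ZMod 2) :=
  {f | IsChain1Z2 G f ∧ ∀ v, chainDivZ2 f v = 0}

/-- A circuit: a closed walk (based at some vertex). -/
abbrev Circuit (G : SimpleGraph V) := Σ v : V, G.Walk v v

/-- Number of traversals of the oriented edge `(a, b)` by the walk `p`. -/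
noncomputable def traversals {G : SimpleGraph V} {u v : V} (p : G.Walk u v) (a b : V) : ℕ :=
  ((Finset.range p.length).filter fun i => p.getVert i = a ∧ p.getVert (i + 1) = b).card

/-- The integer 1-chain of signed traversals of a walk. -/
noncomputable def walkChain {G : SimpleGraph V} {u v : V} (p : G.Walk u v) (a b : V) : ℤ :=
  (traversals p a b : ℤ) - (traversals p b a : ℤ)

/-- The mod-2 1-chain of traversals of a walk. -/
noncomputable def walkChainZ2 {G : SimpleGraph V} {u v : V} (p : G.Walk u v) (a b : V) : ZMod 2 :=
  (traversals p a b : ZMod 2) + (traversals p b a : ZMod 2)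

/-- The walk `p` passes through the edge `{a, b}`. -/
def OnWalk {G : SimpleGraph V} {u v : V} (p : G.Walk u v) (a b : V) : Prop :=
  ∃ i < p.length, (p.getVert i = a ∧ p.getVert (i + 1) = b) ∨
    (p.getVert i = b ∧ p.getVert (i + 1) = a)

/-- A coefficient family on circuits is thin (locally finite). -/
def ThinCoef (G : SimpleGraph V) (g : Circuit G → ℤ) : Prop :=
  ∀ a b : V, {c : Circuit G | g c ≠ 0 ∧ OnWalk c.2 a b}.Finite

def ThinCoefZ2 (G : SimpleGraph V) (g : Circuit G → ZMod 2) : Prop :=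
  ∀ a b : V, {c : Circuit G | g c ≠ 0 ∧ OnWalk c.2 a b}.Finite

/-- The 1-chain obtained as the (pointwise) sum of a family of circuits with coefficients. -/
noncomputable def circSum (G : SimpleGraph V) (g : Circuit G → ℤ) : V → V → ℤ :=
  fun a b => ∑ᶠ c : Circuit G, g c * walkChain c.2 a b

noncomputable def circSumZ2 (G : SimpleGraph V) (g : Circuit G → ZMod 2) : V → V → ZMod 2 :=
  fun a b => ∑ᶠ c : Circuit G, g c * walkChainZ2 c.2 a b

/-- 𝒞_r(X, ℤ): sums of circuits of length ≤ r with uniformly bounded integer coefficients. -/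
def Cr (G : SimpleGraph V) (r : ℕ) : Set (V → V → ℤ) :=
  {f | ∃ g : Circuit G → ℤ, (∃ C : ℕ, ∀ c, |g c| ≤ (C : ℤ)) ∧
    (∀ c, g c ≠ 0 → c.2.length ≤ r) ∧ ThinCoef G g ∧ f = circSum G g}

/-- 𝒞_∞(X, ℤ). -/
def Cinf (G : SimpleGraph V) : Set (V → V → ℤ) := ⋃ r : ℕ, Cr G r

/-- 𝒞(X, ℤ): thin sums of circuits with integer coefficients whose result is bounded. -/
def Cthin (G : SimpleGraph V) : Set (V → V → ℤ) :=
  {f | ∃ g : Circuit G → ℤ, ThinCoef G g ∧ (∃ C, Bdd f C) ∧ f = circSum G g}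

/-- 𝒞_r(X, ℤ₂). -/
def CrZ2 (G : SimpleGraph V) (r : ℕ) : Set (V → V → ZMod 2) :=
  {f | ∃ g : Circuit G → ZMod 2, (∀ c, g c ≠ 0 → c.2.length ≤ r) ∧
    ThinCoefZ2 G g ∧ f = circSumZ2 G g}

/-- 𝒞_∞(X, ℤ₂). -/
def CinfZ2 (G : SimpleGraph V) : Set (V → V → ZMod 2) := ⋃ r : ℕ, CrZ2 G r

/-- 𝒞(X, ℤ₂): thin sums of circuits mod 2. -/
def CthinZ2 (G : SimpleGraph V) : Set (V → V → ZMod 2) :=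
  {f | ∃ g : Circuit G → ZMod 2, ThinCoefZ2 G g ∧ f = circSumZ2 G g}

/-- `a` and `b` are joined by a walk avoiding the set `K`. -/
def ConnAvoiding (G : SimpleGraph V) (K : Set V) (a b : V) : Prop :=
  ∃ p : G.Walk a b, ∀ v ∈ p.support, v ∉ K

/-- A (one-sided infinite) ray in `G`. -/
def IsRay (G : SimpleGraph V) (x : ℕ → V) : Prop :=
  Function.Injective x ∧ ∀ n, G.Adj (x n) (x (n + 1))

/-- Two rays determine the same end. -/
def RayEquiv (G : SimpleGraph V) (x y : ℕ → V) : Prop :=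
  ∀ K : Finset V, ∃ N, ∀ n, N ≤ n → ∀ m, N ≤ m → ConnAvoiding G (↑K) (x n) (y m)

/-- The connected component of `v` in `X − K`. -/
def Component (G : SimpleGraph V) (K : Set V) (v : V) : Set V :=
  {u | u ∉ K ∧ ConnAvoiding G K u v}

def MoreThanOneEnd (G : SimpleGraph V) : Prop :=
  ∃ K : Finset V, ∃ v w : V, v ∉ K ∧ w ∉ K ∧ (Component G (↑K) v).Infinite ∧
    (Component G (↑K) w).Infinite ∧ ¬ ConnAvoiding G (↑K) v w

def OneEnded (G : SimpleGraph V) : Prop :=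
  Infinite V ∧ ∀ K : Finset V, ∃ v, v ∉ K ∧ (Component G (↑K) v).Infinite ∧
    ∀ u, u ∉ K → (Component G (↑K) u).Infinite → ConnAvoiding G (↑K) u v

/-- A bip: a bi-infinite path, i.e. injective graph morphism ℤ → T. -/
def IsBip (T : SimpleGraph V) (b : ℤ → V) : Prop :=
  Function.Injective b ∧ ∀ n : ℤ, T.Adj (b n) (b (n + 1))

/-- The bip `b` lies over the edge `{u, v}`. -/
def LiesOver (b : ℤ → V) (u v : V) : Prop :=
  ∃ n : ℤ, (b n = u ∧ b (n + 1) = v) ∨ (b n = v ∧ b (n + 1) = u)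

/-- The signed traversal of the oriented edge `(u, v)` by the bip `b`. -/
noncomputable def bipSign (b : ℤ → V) (u v : V) : ℤ :=
  if ∃ n : ℤ, b n = u ∧ b (n + 1) = v then 1
  else if ∃ n : ℤ, b n = v ∧ b (n + 1) = u then -1 else 0

noncomputable def bipOverZ2 (b : ℤ → V) (u v : V) : ZMod 2 :=
  if LiesOver b u v then 1 else 0

/-- `p` is the last bip of `P` (w.r.t. the order `r`) lying over the edge `{u, v}`. -/
def IsLast (P : Set (ℤ → V)) (r : (ℤ → V) → (ℤ → V) → Prop) (p : ℤ → V) (u v : V) : Prop :=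
  LiesOver p u v ∧ ∀ q ∈ P, q ≠ p → LiesOver q u v → r q p

/-- The 1-chain associated to coefficients on a family of bips. -/
noncomputable def bipMap (P : Set (ℤ → V)) (f : ↥P → ℤ) : V → V → ℤ :=
  fun u v => ∑ᶠ p : ↥P, f p * bipSign p.1 u v

noncomputable def bipMapZ2 (P : Set (ℤ → V)) (f : ↥P → ZMod 2) : V → V → ZMod 2 :=
  fun u v => ∑ᶠ p : ↥P, f p * bipOverZ2 p.1 u v

/-- The set `S` is connected in the graph `H` (walks staying inside `S`). -/
def ConnectedIn (H : SimpleGraph V) (S : Set V) : Prop :=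
  ∀ a ∈ S, ∀ b ∈ S, ∃ p : H.Walk a b, ∀ v ∈ p.support, v ∈ S

/-- `T` is a subtree of `G`. -/
def IsSubtree (G T : SimpleGraph V) : Prop :=
  T ≤ G ∧ T.IsAcyclic ∧ T.support.Nonempty ∧ ConnectedIn T T.support

/-- Every vertex of `T` has degree ≥ 2 in `T`. -/
def Leafless (T : SimpleGraph V) : Prop :=
  ∀ v ∈ T.support, ∃ u w : V, u ≠ w ∧ T.Adj v u ∧ T.Adj v w

/-- Distinct ends of `T` determine distinct ends of `G`. -/
def EndRespecting (G T : SimpleGraph V) : Prop :=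
  ∀ x y : ℕ → V, IsRay T x → IsRay T y → RayEquiv G x y → RayEquiv T x y

/-- Every end of `G` is represented by a unique end of `T`. -/
def EndDefining (G T : SimpleGraph V) : Prop :=
  EndRespecting G T ∧ ∀ x : ℕ → V, IsRay G x → ∃ y : ℕ → V, IsRay T y ∧ RayEquiv G x y

/-- The subtree `T` of `G` has separators. -/
def HasSeparators (G T : SimpleGraph V) : Prop :=
  ∃ K : ℕ → Finset V,
    (∀ n, K n ⊆ K (n + 1)) ∧
    (∀ v : V, ∃ n, v ∈ K n) ∧
    (∀ n, ConnectedIn G (↑(K n))) ∧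
    (∀ n, ConnectedIn T (T.support ∩ ↑(K n))) ∧
    (∀ n, ∀ v : V, v ∉ K n → (Component G (↑(K n)) v).Infinite →
      ∃! e : V × V, T.Adj e.1 e.2 ∧ e.1 ∈ K n ∧ e.2 ∉ K n ∧
        e.2 ∈ Component G (↑(K n)) v) ∧
    (∀ n, ∀ a b : V, T.Adj a b → a ∈ K n → b ∉ K n → (Component G (↑(K n)) b).Infinite)

/-- An integer 2-chain: alternating, supported on triangles. -/
def IsChain2 (G : SimpleGraph V) (g : V → V → V → ℤ) : Prop :=
  (∀ u v w, g u v w = - g v u w) ∧ (∀ u v w, g u v w = - g u w v) ∧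
    ∀ u v w, g u v w ≠ 0 → G.Adj u v ∧ G.Adj v w ∧ G.Adj u w

def Bdd2 (g : V → V → V → ℤ) (C : ℕ) : Prop := ∀ u v w, |g u v w| ≤ (C : ℤ)

/-- The boundary of a 2-chain. -/
noncomputable def bd2 (g : V → V → V → ℤ) : V → V → ℤ := fun u v => ∑ᶠ w, g u v w

/-- `H^suf_1`-expansion. -/
def HsufExp1 (G : SimpleGraph V) : Prop :=
  ∃ K : ℕ → ℕ, ∀ U : Finset V, ∀ f : V → V → ℤ,
    IsChain1 G f →
    (∀ u v, f u v ≠ 0 → u ∈ U ∧ v ∈ U) →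
    (∀ v ∈ U, (∀ u, G.Adj u v → u ∈ U) → chainDiv f v = 0) →
    (∃ fh ∈ Zsuf1 G, (∀ u ∈ U, ∀ v ∈ U, fh u v = f u v) ∧ chainNorm fh = chainNorm f) →
    ∃ g : V → V → V → ℤ, IsChain2 G g ∧ Bdd2 g (K (chainNorm f)) ∧
      ∀ u ∈ U, ∀ v ∈ U, bd2 g u v = f u v

/-- Pure `H^suf_1`-expansion. -/
def PureHsufExp1 (G : SimpleGraph V) : Prop :=
  ∃ K : ℕ → ℕ, ∀ U : Finset V, ∀ f : V → V → ℤ,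
    IsChain1 G f →
    (∀ u v, f u v ≠ 0 → u ∈ U ∧ v ∈ U) →
    (∀ v ∈ U, (∀ u, G.Adj u v → u ∈ U) → chainDiv f v = 0) →
    (∃ fh : V → V → ℤ, IsChain1 G fh ∧
        (∃ g2 : V → V → V → ℤ, IsChain2 G g2 ∧ (∃ C, Bdd2 g2 C) ∧ bd2 g2 = fh) ∧
        (∀ u ∈ U, ∀ v ∈ U, fh u v = f u v) ∧ chainNorm fh = chainNorm f) →
    ∃ g : V → V → V → ℤ, IsChain2 G g ∧ Bdd2 g (K (chainNorm f)) ∧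
      ∀ u ∈ U, ∀ v ∈ U, bd2 g u v = f u v

/-- The Rips graph of radius `s`. -/
def rips (G : SimpleGraph V) (s : ℕ) : SimpleGraph V :=
  SimpleGraph.fromRel fun u v => G.dist u v ≤ s

/-- Pure `H^uf_1`-expansion: the Rips graphs eventually have pure `H^suf_1`-expansion. -/
def PureHufExp1 (G : SimpleGraph V) : Prop := ∃ s₀ : ℕ, ∀ s, s₀ ≤ s → PureHsufExp1 (rips G s)

def VertexTransitive (G : SimpleGraph V) : Prop := ∀ u v : V, ∃ φ : G ≃g G, φ u = v

/-- The edge boundary of a finite set of vertices. -/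
def edgeBoundary (G : SimpleGraph V) (U : Finset V) : Set (Sym2 V) :=
  {e | e ∈ G.edgeSet ∧ ∃ a b : V, e = s(a, b) ∧ a ∈ U ∧ b ∉ U}

/-- Mod-2 reduction of an integer 1-chain. -/
def mod2 (f : V → V → ℤ) : V → V → ZMod 2 := fun u v => ((f u v : ℤ) : ZMod 2)

/-- Pointwise domination of 1-chains: `r` flows in the same direction as `φ`, no stronger. -/
def chainLE (r φ : V → V → ℤ) : Prop :=
  ∀ u v, (0 ≤ φ u v → 0 ≤ r u v ∧ r u v ≤ φ u v) ∧ (φ u v ≤ 0 → φ u v ≤ r u v ∧ r u v ≤ 0)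

/-- A set of functions is locally finite (thin). -/
def ThinFamily {Y : Type} (F : Set (Y → ZMod 2)) : Prop := ∀ y : Y, {f ∈ F | f y ≠ 0}.Finite

/-- The pointwise sum of a (thin) set of functions. -/
noncomputable def thinSum {Y : Type} (F : Set (Y → ZMod 2)) : Y → ZMod 2 :=
  fun y => ∑ᶠ f : ↥F, f.1 y

/-- A thin-sum space: a subspace closed under thin sums. -/
def IsThinSumSpace {Y : Type} (W : Set (Y → ZMod 2)) : Prop :=
  0 ∈ W ∧ (∀ f ∈ W, ∀ g ∈ W, f + g ∈ W) ∧ ∀ F ⊆ W, ThinFamily F → thinSum F ∈ W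

/-- A thin-sum basis for a thin-sum space. -/
def IsThinSumBasis {Y : Type} (A W : Set (Y → ZMod 2)) : Prop :=
  A ⊆ W ∧ (∀ f ∈ W, ∃ F ⊆ A, ThinFamily F ∧ f = thinSum F) ∧
    ∀ F ⊆ A, ThinFamily F → F.Nonempty → thinSum F ≠ 0

/-- A finitely supported integer flow, with support inside `S × S`. -/
structure FinFlow (G : SimpleGraph V) (S : Finset V) (f : V → V → ℤ) : Prop where
  chain : IsChain1 G f
  mem_left : ∀ u v, f u v ≠ 0 → u ∈ S
  div_eq_zero : ∀ v, ∑ u ∈ S, f u v = 0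

namespace FinFlow

variable {G : SimpleGraph V} {S : Finset V} {f g : V → V → ℤ}

lemma mem_right (hf : FinFlow G S f) (u v : V) (h : f u v ≠ 0) : v ∈ S :=
  hf.mem_left v u fun h0 => h (by rw [hf.chain.1, h0, neg_zero])

/-- Quotients of finite flows by integers dividing all their values are finite flows. -/
lemma of_mul_eq {m : ℤ} (hm : m ≠ 0) (hf : FinFlow G S f) (h : ∀ u v, m * g u v = f u v) :
    FinFlow G S g := by
  have hne : ∀ u v, g u v ≠ 0 → f u v ≠ 0 := fun u v hg => by
    rw [← h]; exact mul_ne_zero hm hg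
  refine ⟨⟨fun u v => ?_, fun u v hg => hf.chain.2 u v (hne u v hg)⟩,
    fun u v hg => hf.mem_left u v (hne u v hg), fun v => ?_⟩
  · apply mul_left_cancel₀ hm
    rw [h, mul_neg, h, hf.chain.1]
  · apply mul_left_cancel₀ hm
    rw [Finset.mul_sum, mul_zero, ← hf.div_eq_zero v]
    exact Finset.sum_congr rfl fun u _ => h u v

lemma add_mul (m : ℤ) (hf : FinFlow G S f) (hg : FinFlow G S g) :
    FinFlow G S (fun u v => f u v + m * g u v) := by
  have hne : ∀ u v, f u v + m * g u v ≠ 0 → f u v ≠ 0 ∨ g u v ≠ 0 := fun u v h => by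
    by_contra! h'
    simp [h'.1, h'.2] at h
  refine ⟨⟨fun u v => ?_, fun u v h => ?_⟩, fun u v h => ?_, fun v => ?_⟩
  · dsimp only
    rw [hf.chain.1 u v, hg.chain.1 u v]; ring
  · exact (hne u v h).elim (hf.chain.2 u v) (hg.chain.2 u v)
  · exact (hne u v h).elim (hf.mem_left u v) (hg.mem_left u v)
  · rw [Finset.sum_add_distrib, ← Finset.mul_sum, hf.div_eq_zero, hg.div_eq_zero]; ring

end FinFlow

/-- The 1-chain of the single oriented edge `(a, b)`. -/
noncomputable def edgeChain (a b u v : V) : ℤ :=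
  (if u = a ∧ v = b then 1 else 0) - (if u = b ∧ v = a then 1 else 0)

lemma sum_edgeChain {S : Finset V} {a b : V} (ha : a ∈ S) (hb : b ∈ S) (v : V) :
    ∑ u ∈ S, edgeChain a b u v = (if v = b then 1 else 0) - (if v = a then 1 else 0) := by
  simp [edgeChain, Finset.sum_sub_distrib, ite_and, ha, hb]

lemma edgeChain_antisymm (a b u v : V) : edgeChain a b u v = - edgeChain a b v u := by
  simp only [edgeChain, and_comm (a := v = a), and_comm (a := v = b)]
  ring

/-- The set of vertices reachable from `v₀` in at most `n` steps along positive edges of `f`. -/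
def posReach (f : V → V → ℤ) (v₀ : V) : ℕ → Set V
  | 0 => {v₀}
  | n + 1 => posReach f v₀ n ∪ {w | ∃ u ∈ posReach f v₀ n, 0 < f u w}

lemma start_mem_posReach (f : V → V → ℤ) (v₀ : V) : ∀ n, v₀ ∈ posReach f v₀ n
  | 0 => rfl
  | n + 1 => Or.inl (start_mem_posReach f v₀ n)

/-- The end of a positive edge of a finite flow leads back to its start along positive edges. -/
lemma exists_mem_posReach {G : SimpleGraph V} {S : Finset V} {f : V → V → ℤ}
    (hf : FinFlow G S f) {u₀ v₀ : V} (h : 0 < f u₀ v₀) : ∃ n, u₀ ∈ posReach f v₀ n := by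
  by_contra! hcon
  set R : Set V := {w | ∃ n, w ∈ posReach f v₀ n} with hR
  have hclosed : ∀ u w, u ∈ R → w ∉ R → 0 ≤ f w u := by
    rintro u w ⟨n, hn⟩ hw
    by_contra! hlt
    exact hw ⟨n + 1, Or.inr ⟨u, hn, by rw [hf.chain.1]; omega⟩⟩
  have hv : v₀ ∈ R := ⟨0, rfl⟩
  have hu : u₀ ∉ R := fun ⟨n, hn⟩ => hcon n hn
  have hS := hf.mem_left u₀ v₀ h.ne'
  have hS' := hf.mem_right u₀ v₀ h.ne'
  set A := S.filter (· ∈ R)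
  set B := S.filter (· ∉ R)
  have h1 : ∑ w ∈ A, ∑ u ∈ S, f u w = 0 := Finset.sum_eq_zero fun w _ => hf.div_eq_zero w
  have h2 : ∑ w ∈ A, ∑ u ∈ A, f u w = 0 := by
    have : ∑ w ∈ A, ∑ u ∈ A, f u w = - ∑ w ∈ A, ∑ u ∈ A, f u w := by
      conv_lhs => rw [Finset.sum_comm]
      rw [← Finset.sum_neg_distrib]
      refine Finset.sum_congr rfl fun w _ => ?_
      rw [← Finset.sum_neg_distrib]
      exact Finset.sum_congr rfl fun u _ => hf.chain.1 _ _
    omega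
  have h3 : ∑ w ∈ A, ∑ u ∈ B, f u w = 0 := by
    have : ∑ w ∈ A, ∑ u ∈ S, f u w = ∑ w ∈ A, ∑ u ∈ A, f u w + ∑ w ∈ A, ∑ u ∈ B, f u w := by
      rw [← Finset.sum_add_distrib]
      exact Finset.sum_congr rfl fun w _ => (Finset.sum_filter_add_sum_filter_not _ _ _).symm
    omega
  have h4 : 0 < ∑ w ∈ A, ∑ u ∈ B, f u w := by
    have hnn : ∀ w ∈ A, ∀ u ∈ B, 0 ≤ f u w := fun w hw u hu =>
      hclosed w u (Finset.mem_filter.1 hw).2 (Finset.mem_filter.1 hu).2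
    refine Finset.sum_pos' (fun w hw => Finset.sum_nonneg (hnn w hw))
      ⟨v₀, Finset.mem_filter.2 ⟨hS', hv⟩, ?_⟩
    exact Finset.sum_pos' (hnn v₀ (Finset.mem_filter.2 ⟨hS', hv⟩))
      ⟨u₀, Finset.mem_filter.2 ⟨hS, hu⟩, h⟩
  omega

/-- A simple path along positive edges of `f`, as a 1-chain. -/
lemma exists_pathChain {G : SimpleGraph V} {S : Finset V} {f : V → V → ℤ}
    (hf : FinFlow G S f) {v₀ : V} (n : ℕ) : ∀ w ∈ posReach f v₀ n,
    ∃ p : V → V → ℤ, (∀ u v, p u v = - p v u) ∧ (∀ u v, p u v ≤ 1) ∧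
      (∀ u v, p u v = 1 → 0 < f u v) ∧ (∀ u v, p u v ≠ 0 → u ∈ posReach f v₀ n) ∧
      (∀ u, p u v₀ ≤ 0) ∧
      ∀ v, ∑ u ∈ S, p u v = (if v = w then 1 else 0) - (if v = v₀ then 1 else 0) := by
  induction n with
  | zero =>
    rintro w rfl
    exact ⟨fun _ _ => 0, by simp, by simp, by simp, by simp, by simp, by simp⟩
  | succ n ih =>
    intro w hw
    by_cases hwn : w ∈ posReach f v₀ n
    · obtain ⟨p, h1, h2, h3, h4, h5, h6⟩ := ih w hwn
      exact ⟨p, h1, h2, h3, fun u v h => Or.inl (h4 u v h), h5, h6⟩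
    obtain ⟨x, hx, hxw⟩ := hw.resolve_left hwn
    obtain ⟨p, h1, h2, h3, h4, h5, h6⟩ := ih x hx
    have hpw : ∀ u, p w u = 0 := fun u => by
      by_contra h
      exact hwn (h4 w u h)
    have hpw' : ∀ u, p u w = 0 := fun u => by rw [h1, hpw, neg_zero]
    have hwv : v₀ ≠ w := fun h => hwn (h ▸ start_mem_posReach f v₀ n)
    have hxw' : x ≠ w := fun h => hwn (h ▸ hx)
    refine ⟨fun u v => p u v + edgeChain x w u v, fun u v => ?_, fun u v => ?_, fun u v h => ?_,
      fun u v h => ?_, fun u => ?_, fun v => ?_⟩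
    · dsimp only
      rw [h1 u v, edgeChain_antisymm x w u v]; ring
    · have := h2 u v
      by_cases hv : v = w
      · subst hv
        simp only [hpw', edgeChain]
        split_ifs <;> simp
      · simp only [edgeChain, hv, and_false, if_false]
        split_ifs <;> omega
    · by_cases hv : v = w
      · subst hv
        by_cases hu : u = x
        · rw [hu]; exact hxw
        · simp [hpw', edgeChain, hu, hxw'.symm] at h
      · by_cases hu : u = w
        · subst hu
          simp only [hpw, edgeChain, hv, and_false, if_false] at h
          split_ifs at h <;> omega
        · simp only [edgeChain, hv, hu, and_false, false_and, if_false] at h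
          exact h3 u v (by omega)
    · by_cases hp : p u v = 0
      · by_cases hu : u = x
        · exact Or.inl (hu ▸ hx)
        · by_cases hu' : u = w
          · exact Or.inr ⟨x, hx, hu' ▸ hxw⟩
          · simp [hp, edgeChain, hu, hu'] at h
      · exact Or.inl (h4 u v hp)
    · have := h5 u
      simp only [edgeChain, hwv, and_false, if_false]
      split_ifs <;> omega
    · rw [Finset.sum_add_distrib, h6, sum_edgeChain (hf.mem_left x w hxw.ne')
        (hf.mem_right x w hxw.ne')]
      ring

/-- Through every edge with positive flow runs a directed cycle of edges with positive flow. -/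
lemma exists_cycleFlow {G : SimpleGraph V} {S : Finset V} {f : V → V → ℤ}
    (hf : FinFlow G S f) {u₀ v₀ : V} (h : 0 < f u₀ v₀) :
    ∃ z : V → V → ℤ, FinFlow G S z ∧ (∀ u v, z u v ≤ 1) ∧ (∀ u v, z u v = 1 → 0 < f u v) ∧
      z u₀ v₀ = 1 := by
  obtain ⟨n, hn⟩ := exists_mem_posReach hf h
  obtain ⟨p, h1, h2, h3, -, h5, h6⟩ := exists_pathChain hf n u₀ hn
  have hne : u₀ ≠ v₀ := by
    rintro rfl
    have := hf.chain.1 u₀ u₀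
    omega
  have hp : p u₀ v₀ = 0 := by
    have a1 := h5 u₀
    have a2 := h1 u₀ v₀
    have a3 := h2 v₀ u₀
    have a4 := h3 v₀ u₀
    have a5 := hf.chain.1 u₀ v₀
    omega
  have hp' : p v₀ u₀ = 0 := by rw [h1, hp, neg_zero]
  have hz : ∀ u v, p u v + edgeChain u₀ v₀ u v ≤ 1 := fun u v => by
    have := h2 u v
    by_cases huv : u = u₀ ∧ v = v₀
    · obtain ⟨rfl, rfl⟩ := huv
      simp only [hp, edgeChain]
      split_ifs <;> simp
    · simp only [edgeChain, huv, if_false]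
      split_ifs <;> omega
  have hanti : ∀ u v, p u v + edgeChain u₀ v₀ u v = -(p v u + edgeChain u₀ v₀ v u) :=
    fun u v => by rw [h1 u v, edgeChain_antisymm u₀ v₀ u v]; ring
  have hpos : ∀ u v, p u v + edgeChain u₀ v₀ u v = 1 → 0 < f u v := fun u v he => by
    by_cases huv : u = u₀ ∧ v = v₀
    · rw [huv.1, huv.2]; exact h
    · by_cases huv' : u = v₀ ∧ v = u₀
      · simp [huv'.1, huv'.2, hp', edgeChain, hne, hne.symm] at he
      · simp only [edgeChain, huv, huv', if_false] at he
        exact h3 u v (by omega)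
  have hsupp : ∀ u v, p u v + edgeChain u₀ v₀ u v ≠ 0 → f u v ≠ 0 := fun u v he => by
    have a1 := hpos u v
    have a2 := hpos v u
    have a3 := hz u v
    have a4 := hz v u
    have a5 := hanti u v
    have a6 := hf.chain.1 u v
    omega
  refine ⟨fun u v => p u v + edgeChain u₀ v₀ u v, ⟨⟨hanti, fun u v he =>
    hf.chain.2 u v (hsupp u v he)⟩, fun u v he => hf.mem_left u v (hsupp u v he), fun v => ?_⟩,
    hz, hpos, ?_⟩
  · rw [Finset.sum_add_distrib, h6, sum_edgeChain (hf.mem_left u₀ v₀ h.ne')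
      (hf.mem_right u₀ v₀ h.ne')]
    ring
  · simp [hp, edgeChain, hne]

/-- Every finite flow is congruent modulo `2` to a finite flow of norm at most `1`. -/
lemma exists_flow_congr_two {G : SimpleGraph V} {S : Finset V} (N : ℕ) :
    ∀ f : V → V → ℤ, FinFlow G S f → ∑ u ∈ S, ∑ v ∈ S, (f u v).natAbs = N →
    ∃ e, FinFlow G S e ∧ Bdd e 1 ∧ ∀ u v, (2 : ℤ) ∣ f u v - e u v := by
  induction N using Nat.strong_induction_on with
  | _ N ih =>
    intro f hf hN
    by_cases hb : Bdd f 1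
    · exact ⟨f, hf, hb, by simp⟩
    obtain ⟨u₀, v₀, h⟩ : ∃ u₀ v₀, 2 ≤ f u₀ v₀ := by
      simp only [Bdd, not_forall, not_le] at hb
      obtain ⟨u, v, h⟩ := hb
      rcases lt_abs.1 h with h | h
      · exact ⟨u, v, by push_cast at h; omega⟩
      · exact ⟨v, u, by rw [hf.chain.1]; push_cast at h; omega⟩
    obtain ⟨z, hz, hz1, hzf, hz0⟩ := exists_cycleFlow hf (u₀ := u₀) (v₀ := v₀) (by omega)
    have hle : ∀ u v, (f u v + (-2) * z u v).natAbs ≤ (f u v).natAbs := fun u v => by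
      have a1 := hzf u v
      have a2 := hzf v u
      have a3 := hz1 u v
      have a4 := hz1 v u
      have a5 := hz.chain.1 u v
      have a6 := hf.chain.1 u v
      omega
    have hu := hf.mem_left u₀ v₀ (by omega)
    have hv := hf.mem_right u₀ v₀ (by omega)
    have hlt : ∑ u ∈ S, ∑ v ∈ S, (f u v + (-2) * z u v).natAbs < N := by
      rw [← hN]
      refine Finset.sum_lt_sum (fun u _ => Finset.sum_le_sum fun v _ => hle u v) ⟨u₀, hu, ?_⟩
      exact Finset.sum_lt_sum (fun v _ => hle u₀ v) ⟨v₀, hv, by rw [hz0]; omega⟩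
    obtain ⟨e, he, he1, hd⟩ := ih _ hlt _ (hf.add_mul (-2) hz) rfl
    refine ⟨e, he, he1, fun u v => ?_⟩
    have := hd u v
    omega

lemma FinFlow.exists_halves {G : SimpleGraph V} {S : Finset V} {f : V → V → ℤ}
    (hf : FinFlow G S f) {m : ℕ} (hm : Bdd f (2 * m)) :
    ∃ f₁ f₂, FinFlow G S f₁ ∧ FinFlow G S f₂ ∧ Bdd f₁ m ∧ Bdd f₂ m ∧ f = f₁ + f₂ := by
  obtain ⟨e, he, he1, hd⟩ := exists_flow_congr_two _ f hf rfl
  choose d hd using hd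
  have key : ∀ u v, |d u v| ≤ m ∧ |d u v + e u v| ≤ m := fun u v => by
    have a1 := abs_le.1 (hm u v)
    have a2 := abs_le.1 (he1 u v)
    have a3 := hd u v
    push_cast at a1 a2
    constructor <;> rw [abs_le] <;> constructor <;> omega
  refine ⟨d, fun u v => d u v + e u v,
    (hf.add_mul (-1) he).of_mul_eq (m := 2) (by norm_num) (fun u v => by linarith [hd u v]),
    (hf.add_mul 1 he).of_mul_eq (m := 2) (by norm_num) (fun u v => by linarith [hd u v]),
    fun u v => (key u v).1, fun u v => (key u v).2, ?_⟩
  funext u v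
  have := hd u v
  simp only [Pi.add_apply]
  omega

lemma finite_walk_ball {G : SimpleGraph V} (h : ∀ v, (G.neighborSet v).Finite) (n : ℕ) :
    ∀ a, {w | ∃ p : G.Walk a w, p.length ≤ n}.Finite := by
  induction n with
  | zero =>
    intro a
    refine (Set.finite_singleton a).subset ?_
    rintro w ⟨p, hp⟩
    exact (SimpleGraph.Walk.eq_of_length_eq_zero (p := p) (by omega)).symm
  | succ n ih =>
    intro a
    refine ((Set.finite_singleton a).union ((h a).biUnion fun b _ => ih b)).subset ?_
    rintro w ⟨p, hp⟩
    cases p with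
    | nil => exact Or.inl rfl
    | cons hab q =>
      refine Or.inr (Set.mem_biUnion hab ⟨q, ?_⟩)
      simpa using hp

lemma circuit_ext {G : SimpleGraph V} {c d : Circuit G} (h : c.2.support = d.2.support) :
    c = d := by
  obtain ⟨u, p⟩ := c
  obtain ⟨v, q⟩ := d
  obtain rfl : u = v := by
    have h1 := p.head_support
    have h2 := q.head_support
    simp only at h
    rw [← h1, ← h2]
    congr 1
  exact congrArg _ (SimpleGraph.Walk.ext_support h)

/-- The circuits of length at most `s` through the vertex `a`. -/
def circuitsAt (G : SimpleGraph V) (s : ℕ) (a : V) : Set (Circuit G) :=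
  {c | c.2.length ≤ s ∧ a ∈ c.2.support}

lemma finite_circuitsAt {G : SimpleGraph V} (h : ∀ v, (G.neighborSet v).Finite) (s : ℕ) (a : V) :
    (circuitsAt G s a).Finite := by
  set B := {w | ∃ p : G.Walk a w, p.length ≤ s + s}
  have hB : Finite B := finite_walk_ball h (s + s) a
  refine Set.Finite.of_finite_image (f := fun c : Circuit G => c.2.support) ?_
    fun c _ d _ hcd => circuit_ext hcd
  refine ((List.finite_length_le B (s + 1)).image (List.map Subtype.val)).subset ?_
  rintro _ ⟨⟨v, p⟩, ⟨hl, ha⟩, rfl⟩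
  have hmem : ∀ w ∈ p.support, w ∈ B := fun w hw => by
    refine ⟨(p.takeUntil a ha).reverse.append (p.takeUntil w hw), ?_⟩
    have h1 := p.length_takeUntil_le_length ha
    have h2 := p.length_takeUntil_le_length hw
    simp only [SimpleGraph.Walk.length_append, SimpleGraph.Walk.length_reverse]
    simp only at hl
    omega
  refine ⟨p.support.attach.map fun w => ⟨w.1, hmem w.1 w.2⟩, ?_, ?_⟩
  · simpa using hl
  · simp [List.map_map, Function.comp_def]

/-- The action of graph automorphisms on circuits. -/
def mapCircuit {G : SimpleGraph V} (φ : G ≃g G) : Circuit G ≃ Circuit G where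
  toFun c := ⟨φ c.1, c.2.map φ.toHom⟩
  invFun c := ⟨φ.symm c.1, c.2.map φ.symm.toHom⟩
  left_inv c := circuit_ext (by simp only [SimpleGraph.Walk.support_map]; simp [Function.comp_def])
  right_inv c := circuit_ext (by simp only [SimpleGraph.Walk.support_map]; simp [Function.comp_def])

lemma length_mapCircuit {G : SimpleGraph V} (φ : G ≃g G) (c : Circuit G) :
    (mapCircuit φ c).2.length = c.2.length :=
  SimpleGraph.Walk.length_map _ _

lemma walkChain_mapCircuit {G : SimpleGraph V} (φ : G ≃g G) (c : Circuit G) (a b : V) :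
    walkChain (mapCircuit φ c).2 (φ a) (φ b) = walkChain c.2 a b := by
  have : ∀ i, (mapCircuit φ c).2.getVert i = φ (c.2.getVert i) := fun i =>
    SimpleGraph.Walk.getVert_map _ _ _
  simp only [walkChain, traversals, length_mapCircuit, this, EmbeddingLike.apply_eq_iff_eq]

lemma ncard_circuitsAt {G : SimpleGraph V} (φ : G ≃g G) (s : ℕ) (a : V) :
    (circuitsAt G s (φ a)).ncard = (circuitsAt G s a).ncard := by
  rw [← Set.ncard_image_of_injective (circuitsAt G s a) (mapCircuit φ).injective]
  congr 1
  rw [(mapCircuit φ).image_eq_preimage_symm]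
  ext c
  obtain ⟨d, rfl⟩ := (mapCircuit φ).surjective c
  simp only [Set.mem_preimage, Equiv.symm_apply_apply, circuitsAt, Set.mem_ofPred_eq,
    length_mapCircuit]
  refine and_congr_right fun _ => ?_
  change φ a ∈ (d.2.map φ.toHom).support ↔ _
  simp [SimpleGraph.Walk.support_map]

section walkChain

variable {G : SimpleGraph V}

lemma walkChain_eq_sum {u v : V} (p : G.Walk u v) (a b : V) :
    walkChain p a b = ∑ i ∈ Finset.range p.length,
      ((if p.getVert i = a ∧ p.getVert (i + 1) = b then (1 : ℤ) else 0) -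
        (if p.getVert i = b ∧ p.getVert (i + 1) = a then 1 else 0)) := by
  simp [walkChain, traversals, Finset.sum_sub_distrib]

lemma walkChain_antisymm {u v : V} (p : G.Walk u v) (a b : V) :
    walkChain p a b = - walkChain p b a := by
  simp [walkChain]

lemma abs_walkChain_le {u v : V} (p : G.Walk u v) (a b : V) :
    |walkChain p a b| ≤ p.length := by
  have key : ∀ x y, traversals p x y ≤ p.length := fun x y =>
    (Finset.card_filter_le _ _).trans_eq (Finset.card_range _)
  have h1 := key a b
  have h2 := key b a
  rw [walkChain, abs_le]
  constructor <;> omega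

lemma onWalk_of_walkChain_ne_zero {u v : V} {p : G.Walk u v} {a b : V}
    (h : walkChain p a b ≠ 0) : OnWalk p a b := by
  by_contra hcon
  simp only [OnWalk, not_exists, not_and, not_or] at hcon
  refine h ?_
  rw [walkChain_eq_sum]
  refine Finset.sum_eq_zero fun i hi => ?_
  have := hcon i (Finset.mem_range.1 hi)
  rw [if_neg (by tauto), if_neg (by tauto), sub_zero]

lemma OnWalk.mem_support {u v : V} {p : G.Walk u v} {a b : V} (h : OnWalk p a b) :
    a ∈ p.support := by
  obtain ⟨i, -, ⟨rfl, -⟩ | ⟨-, rfl⟩⟩ := h <;> exact p.getVert_mem_support _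

lemma OnWalk.adj {u v : V} {p : G.Walk u v} {a b : V} (h : OnWalk p a b) : G.Adj a b := by
  obtain ⟨i, hi, ⟨rfl, rfl⟩ | ⟨rfl, rfl⟩⟩ := h
  · exact p.adj_getVert_succ hi
  · exact (p.adj_getVert_succ hi).symm

lemma finFlow_walkChain (c : Circuit G) {S : Finset V} (hS : ∀ v ∈ c.2.support, v ∈ S) :
    FinFlow G S (walkChain c.2) := by
  refine ⟨⟨walkChain_antisymm _, fun u v h => (onWalk_of_walkChain_ne_zero h).adj⟩,
    fun u v h => hS u (onWalk_of_walkChain_ne_zero h).mem_support, fun v => ?_⟩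
  have hm : ∀ i, c.2.getVert i ∈ S := fun i => hS _ (c.2.getVert_mem_support i)
  have key : ∀ i, ∑ u ∈ S, ((if c.2.getVert i = u ∧ c.2.getVert (i + 1) = v then (1 : ℤ) else 0) -
      (if c.2.getVert i = v ∧ c.2.getVert (i + 1) = u then 1 else 0)) =
      (if c.2.getVert (i + 1) = v then 1 else 0) - (if c.2.getVert i = v then 1 else 0) := by
    intro i
    simp [Finset.sum_sub_distrib, ite_and, hm]
  simp only [walkChain_eq_sum]
  rw [Finset.sum_comm]
  simp only [key]
  rw [Finset.sum_range_sub (fun i => if c.2.getVert i = v then (1 : ℤ) else 0)]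
  simp

end walkChain

/-- Sums of circuits of length at most `r` with coefficients bounded by `K`. -/
def CrBdd (G : SimpleGraph V) (r K : ℕ) : Set (V → V → ℤ) :=
  {f | ∃ g : Circuit G → ℤ, (∀ c, |g c| ≤ (K : ℤ)) ∧
    (∀ c, g c ≠ 0 → c.2.length ≤ r) ∧ f = circSum G g}

section CrBdd

variable {G : SimpleGraph V}

lemma thinCoef_of_length_le (h : ∀ v, (G.neighborSet v).Finite) {g : Circuit G → ℤ} {r : ℕ}
    (hg : ∀ c, g c ≠ 0 → c.2.length ≤ r) : ThinCoef G g := fun a _ =>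
  (finite_circuitsAt h r a).subset fun c hc => ⟨hg c hc.1, hc.2.mem_support⟩

lemma circSum_eq_sum (h : ∀ v, (G.neighborSet v).Finite) {g : Circuit G → ℤ} {r : ℕ}
    (hg : ∀ c, g c ≠ 0 → c.2.length ≤ r) (a b : V) :
    circSum G g a b = ∑ c ∈ (finite_circuitsAt h r a).toFinset, g c * walkChain c.2 a b := by
  refine finsum_eq_sum_of_support_subset _ fun c hc => ?_
  have hc := mul_ne_zero_iff.1 (Function.mem_support.1 hc)
  simpa using ⟨hg c hc.1, (onWalk_of_walkChain_ne_zero hc.2).mem_support⟩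

lemma CrBdd_mono {r s K L : ℕ} (hrs : r ≤ s) (hKL : K ≤ L) : CrBdd G r K ⊆ CrBdd G s L := by
  rintro f ⟨g, h1, h2, h3⟩
  exact ⟨g, fun c => (h1 c).trans (by exact_mod_cast hKL), fun c hc => (h2 c hc).trans hrs, h3⟩

lemma neg_mem_CrBdd {r K : ℕ} {f : V → V → ℤ} (hf : f ∈ CrBdd G r K) : -f ∈ CrBdd G r K := by
  obtain ⟨g, h1, h2, rfl⟩ := hf
  refine ⟨-g, fun c => by simpa using h1 c, fun c hc => h2 c (by simpa using hc), ?_⟩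
  funext a b
  simp [circSum, finsum_neg_distrib]

lemma add_mem_CrBdd (h : ∀ v, (G.neighborSet v).Finite) {r K L : ℕ} {f₁ f₂ : V → V → ℤ}
    (hf₁ : f₁ ∈ CrBdd G r K) (hf₂ : f₂ ∈ CrBdd G r L) : f₁ + f₂ ∈ CrBdd G r (K + L) := by
  obtain ⟨g, h1, h2, rfl⟩ := hf₁
  obtain ⟨g', h1', h2', rfl⟩ := hf₂
  have hlen : ∀ c, (g + g') c ≠ 0 → c.2.length ≤ r := fun c hc => by
    by_cases hgc : g c = 0
    · exact h2' c fun h0 => hc (by simp [hgc, h0])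
    · exact h2 c hgc
  refine ⟨g + g', fun c => ?_, hlen, ?_⟩
  · push_cast
    exact (abs_add_le _ _).trans (add_le_add (h1 c) (h1' c))
  · funext a b
    rw [Pi.add_apply, Pi.add_apply, circSum_eq_sum h h2, circSum_eq_sum h h2',
      circSum_eq_sum h hlen, ← Finset.sum_add_distrib]
    exact Finset.sum_congr rfl fun c _ => (add_mul _ _ _).symm

lemma comp_mem_CrBdd (φ : G ≃g G) {r K : ℕ} {f : V → V → ℤ} (hf : f ∈ CrBdd G r K) :
    (fun a b => f (φ a) (φ b)) ∈ CrBdd G r K := by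
  obtain ⟨g, h1, h2, rfl⟩ := hf
  refine ⟨fun c => g (mapCircuit φ c), fun c => h1 _,
    fun c hc => by rw [← length_mapCircuit φ]; exact h2 _ hc, ?_⟩
  funext a b
  simp only [circSum]
  rw [← finsum_comp_equiv (mapCircuit φ)]
  simp only [walkChain_mapCircuit]

/-- The sum of circuits through finite subsums, continuous in the coefficients. -/
noncomputable def localCircSum (h : ∀ v, (G.neighborSet v).Finite) (r : ℕ) (g : Circuit G → ℤ) :
    V → V → ℤ :=
  fun a b => ∑ c ∈ (finite_circuitsAt h r a).toFinset, g c * walkChain c.2 a b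

lemma continuous_localCircSum (h : ∀ v, (G.neighborSet v).Finite) (r : ℕ) :
    Continuous (localCircSum h r) := by
  refine continuous_pi fun a => continuous_pi fun _ => ?_
  exact continuous_finsetSum _ fun c _ => (continuous_apply c).mul continuous_const

lemma isClosed_CrBdd (h : ∀ v, (G.neighborSet v).Finite) (r K : ℕ) :
    IsClosed (CrBdd G r K) := by
  set A : Circuit G → Set ℤ := fun c => {x | |x| ≤ (K : ℤ) ∧ (x ≠ 0 → c.2.length ≤ r)}
  have hA : IsCompact (Set.univ.pi A) := isCompact_univ_pi fun c =>
    ((Set.finite_Icc (-(K : ℤ)) K).subset fun x hx => abs_le.1 hx.1).isCompact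
  have : CrBdd G r K = localCircSum h r '' Set.univ.pi A := by
    ext f
    constructor
    · rintro ⟨g, h1, h2, rfl⟩
      exact ⟨g, fun c _ => ⟨h1 c, h2 c⟩, funext₂ fun a b => (circSum_eq_sum h h2 a b).symm⟩
    · rintro ⟨g, hg, rfl⟩
      have h2 : ∀ c, g c ≠ 0 → c.2.length ≤ r := fun c => (hg c trivial).2
      exact ⟨g, fun c => (hg c trivial).1, h2, funext₂ fun a b => (circSum_eq_sum h h2 a b).symm⟩
  rw [this]
  exact (hA.image (continuous_localCircSum h r)).isClosed

lemma FinFlow.mem_CrBdd_of_bdd (h : ∀ v, (G.neighborSet v).Finite) {S : Finset V} {r K : ℕ}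
    (hunit : ∀ f, FinFlow G S f → Bdd f 1 → f ∈ CrBdd G r K) (j : ℕ) :
    ∀ f, FinFlow G S f → Bdd f (2 ^ j) → f ∈ CrBdd G r (2 ^ j * K) := by
  induction j with
  | zero => simpa using hunit
  | succ j ih =>
    intro f hf hb
    rw [pow_succ'] at hb
    obtain ⟨f₁, f₂, h1, h2, hb1, hb2, rfl⟩ := hf.exists_halves hb
    have := add_mem_CrBdd h (ih f₁ h1 hb1) (ih f₂ h2 hb2)
    rwa [← two_mul, ← mul_assoc, ← pow_succ'] at this

end CrBdd

section Main

variable {G : SimpleGraph V}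

lemma finFlow_sum (A : Finset (Circuit G)) (g : Circuit G → ℤ) {S : Finset V}
    (hS : ∀ c ∈ A, ∀ v ∈ c.2.support, v ∈ S) :
    FinFlow G S (fun a b => ∑ c ∈ A, g c * walkChain c.2 a b) := by
  induction A using Finset.induction_on with
  | empty =>
    exact ⟨⟨by simp, by simp⟩, by simp, by simp⟩
  | insert c A hc ih =>
    have := (ih fun d hd => hS d (Finset.mem_insert_of_mem hd)).add_mul (g c)
      (finFlow_walkChain c (hS c (Finset.mem_insert_self _ _)))
    simpa only [Finset.sum_insert hc, add_comm] using this

lemma bdd_localCircSum (h : ∀ v, (G.neighborSet v).Finite) {g : Circuit G → ℤ} {s M N : ℕ}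
    (hg : ∀ c, |g c| ≤ (M : ℤ)) (hN : ∀ a, (circuitsAt G s a).ncard = N) :
    Bdd (localCircSum h s g) (N * (M * s)) := by
  intro a b
  rw [← hN a, Set.ncard_eq_toFinset_card _ (finite_circuitsAt h s a)]
  refine (Finset.abs_sum_le_sum_abs _ _).trans ?_
  push_cast
  rw [← nsmul_eq_mul]
  refine Finset.sum_le_card_nsmul _ _ _ fun c hc => ?_
  have hc : c ∈ circuitsAt G s a := by simpa using hc
  rw [abs_mul]
  exact mul_le_mul (hg c) ((abs_walkChain_le _ _ _).trans (by exact_mod_cast hc.1))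
    (abs_nonneg _) (by positivity)

/-- Large circuits yield finite flows of norm `1` that are not sums of short circuits with small
coefficients. -/
lemma exists_unit_finFlow (hconn : G.Connected) (htrans : VertexTransitive G) (hulf : ULF G)
    (hlarge : ∀ r : ℕ, Cr G r ≠ Cinf G) (k : ℕ) :
    ∃ S f, FinFlow G S f ∧ Bdd f 1 ∧ f ∉ CrBdd G k k := by
  by_contra! hcon
  have h : ∀ v, (G.neighborSet v).Finite := fun v => (hulf.choose_spec v).1
  obtain ⟨v₀⟩ := hconn.nonempty
  obtain ⟨f, hf, hfk⟩ : ∃ f ∈ Cinf G, f ∉ Cr G k := by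
    by_contra! hsub
    exact hlarge k ((Set.subset_iUnion (Cr G) k).antisymm hsub)
  obtain ⟨s, g, ⟨M, hM⟩, hs, -, rfl⟩ := Set.mem_iUnion.1 hf
  have hN : ∀ a, (circuitsAt G s a).ncard = (circuitsAt G s v₀).ncard := fun a => by
    obtain ⟨φ, rfl⟩ := htrans v₀ a
    exact ncard_circuitsAt φ s v₀
  set N := (circuitsAt G s v₀).ncard
  set j := N * (M * s)
  have hnot : localCircSum h s g ∉ CrBdd G k (2 ^ j * k) := by
    rintro ⟨g', h1, h2, h3⟩
    refine hfk ⟨g', ⟨_, h1⟩, h2, thinCoef_of_length_le h h2, ?_⟩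
    rw [← h3]
    exact funext₂ fun a b => circSum_eq_sum h hs a b
  set gA : Finset (Circuit G) → Circuit G → ℤ := fun A c => if c ∈ A then g c else 0 with hgA
  have hlim : Filter.Tendsto gA Filter.atTop (nhds g) := by
    refine tendsto_pi_nhds.2 fun c => tendsto_const_nhds.congr' ?_
    filter_upwards [Filter.eventually_ge_atTop {c}] with A hA
    rw [hgA]
    simp only
    rw [if_pos (hA (Finset.mem_singleton_self c))]
  obtain ⟨A, hA⟩ := ((((continuous_localCircSum h s).tendsto g).comp hlim).eventually
    ((isClosed_CrBdd h k (2 ^ j * k)).isOpen_compl.mem_nhds hnot)).exists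
  refine hA (FinFlow.mem_CrBdd_of_bdd h (hcon (A.biUnion fun c => c.2.support.toFinset)) j _ ?_ ?_)
  · have hlen : ∀ c, gA A c ≠ 0 → c.2.length ≤ s := fun c hc => hs c fun h0 => hc (by simp [hgA, h0])
    have : localCircSum h s (gA A) = fun a b => ∑ c ∈ A, g c * walkChain c.2 a b := by
      funext a b
      refine (circSum_eq_sum h hlen a b).symm.trans ?_
      refine (finsum_eq_sum_of_support_subset (s := A) _ fun c hc => ?_).trans
        (Finset.sum_congr rfl fun c hc => by simp [hgA, hc])
      by_contra hcA
      exact hc (by simp [hgA, Finset.mem_coe.not.1 hcA])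
    simp only [Function.comp_apply]
    rw [this]
    exact finFlow_sum A g fun c hc v hv => Finset.mem_biUnion.2 ⟨c, hc, by simpa using hv⟩
  · intro a b
    have hb : ∀ c, |gA A c| ≤ (M : ℤ) := fun c => by
      simp only [hgA]
      split_ifs
      · exact hM c
      · simp
    refine (bdd_localCircSum h hb hN a b).trans ?_
    exact_mod_cast Nat.lt_two_pow_self.le

/-- In an infinite vertex-transitive graph finite sets can be moved off each other. -/
lemma exists_iso_disjoint (hinf : Infinite V) (hconn : G.Connected) (htrans : VertexTransitive G)
    (h : ∀ v, (G.neighborSet v).Finite) (S T : Finset V) :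
    ∃ φ : G ≃g G, ∀ s ∈ S, φ s ∉ T := by
  obtain ⟨v₀⟩ := hconn.nonempty
  choose p hp using fun s => hconn.exists_walk_length_eq_dist s v₀
  set D := S.sup fun s => (p s).length
  obtain ⟨w, hw⟩ := (T.finite_toSet.biUnion fun t _ => finite_walk_ball h D t).exists_notMem
  obtain ⟨φ, rfl⟩ := htrans v₀ w
  refine ⟨φ, fun s hs ht => hw (Set.mem_biUnion ht ⟨(p s).map φ.toHom, ?_⟩)⟩
  rw [SimpleGraph.Walk.length_map]
  exact Finset.le_sup (f := fun s => (p s).length) hs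

lemma FinFlow.comp_symm {S : Finset V} {f : V → V → ℤ} (hf : FinFlow G S f) (φ : G ≃g G) :
    FinFlow G (S.map φ.toEquiv.toEmbedding) (fun a b => f (φ.symm a) (φ.symm b)) := by
  refine ⟨⟨fun u v => hf.chain.1 _ _, fun u v he => ?_⟩, fun u v he => ?_, fun v => ?_⟩
  · exact φ.symm.map_adj_iff.1 (hf.chain.2 _ _ he)
  · exact Finset.mem_map.2 ⟨φ.symm u, hf.mem_left _ _ he, by simp⟩
  · rw [Finset.sum_map]
    simpa using hf.div_eq_zero (φ.symm v)

/-- There is a sequence of disjointly supported unit flows that need longer and longer circuits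
or larger and larger coefficients. -/
lemma exists_seq_finFlow (hinf : Infinite V) (hconn : G.Connected) (htrans : VertexTransitive G)
    (hulf : ULF G) (hlarge : ∀ r : ℕ, Cr G r ≠ Cinf G) :
    ∃ (S : ℕ → Finset V) (f : ℕ → V → V → ℤ), (∀ n, FinFlow G (S n) (f n)) ∧
      (∀ n, Bdd (f n) 1) ∧ (∀ n, f n ∉ CrBdd G n n) ∧ ∀ m n, m < n → Disjoint (S m) (S n) := by
  have h : ∀ v, (G.neighborSet v).Finite := fun v => (hulf.choose_spec v).1
  obtain ⟨F, hF, hF'⟩ := exists_seq_of_forall_finset_exists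
    (α := ℕ × Finset V × (V → V → ℤ))
    (fun x => FinFlow G x.2.1 x.2.2 ∧ Bdd x.2.2 1 ∧ x.2.2 ∉ CrBdd G x.1 x.1)
    (fun x y => x.1 < y.1 ∧ Disjoint x.2.1 y.2.1) fun A _ => by
      set k := A.sup (fun x => x.1) + 1
      obtain ⟨S, f, hf, hf1, hfk⟩ := exists_unit_finFlow hconn htrans hulf hlarge k
      obtain ⟨φ, hφ⟩ := exists_iso_disjoint hinf hconn htrans h S (A.biUnion fun x => x.2.1)
      refine ⟨⟨k, S.map φ.toEquiv.toEmbedding, fun a b => f (φ.symm a) (φ.symm b)⟩,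
        ⟨hf.comp_symm φ, fun u v => hf1 _ _, fun hmem => hfk ?_⟩, fun x hx =>
        ⟨Nat.lt_succ_of_le (Finset.le_sup (f := fun x => x.1) hx), ?_⟩⟩
      · simpa using comp_mem_CrBdd φ hmem
      · rw [Finset.disjoint_right]
        intro w hw hwx
        obtain ⟨s, hs, rfl⟩ := Finset.mem_map.1 hw
        exact hφ s hs (Finset.mem_biUnion.2 ⟨x, hx, hwx⟩)
  have hmono : StrictMono fun n => (F n).1 := strictMono_nat_of_lt_succ fun n =>
    (hF' n (n + 1) n.lt_succ_self).1
  refine ⟨fun n => (F n).2.1, fun n => (F n).2.2, fun n => (hF n).1, fun n => (hF n).2.1,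
    fun n hn => (hF n).2.2 (CrBdd_mono hmono.le_apply hmono.le_apply hn),
    fun m n hmn => (hF' m n hmn).2⟩

end Main

/-- for infinite vertex-transitive graphs, ℤ-large circuits imply
H^uf_1(X,ℤ) ≠ 0. -/
theorem stmt13 (G : SimpleGraph V) (hinf : Infinite V) (hconn : G.Connected)
    (htrans : VertexTransitive G) (hulf : ULF G)
    (hlarge : ∀ r : ℕ, Cr G r ≠ Cinf G) :
    ∃ f ∈ Zsuf1 G, f ∉ Cinf G := by
  have h : ∀ v, (G.neighborSet v).Finite := fun v => (hulf.choose_spec v).1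
  obtain ⟨S, f, hf, hf1, hfn, hdisj⟩ := exists_seq_finFlow hinf hconn htrans hulf hlarge
  obtain ⟨κ, hκ⟩ : ∃ κ : V → ℕ, ∀ n, ∀ a ∈ S n, κ a = n := by
    refine ⟨fun a => if ha : ∃ n, a ∈ S n then ha.choose else 0, fun n a ha => ?_⟩
    have hex : ∃ n, a ∈ S n := ⟨n, ha⟩
    simp only [dif_pos hex]
    by_contra hne
    rcases lt_or_gt_of_ne hne with hlt | hlt
    · exact Finset.disjoint_left.1 (hdisj _ _ hlt) hex.choose_spec ha
    · exact Finset.disjoint_left.1 (hdisj _ _ hlt) ha hex.choose_spec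
  have hκl : ∀ n a b, f n a b ≠ 0 → κ a = n := fun n a b hab => hκ n a ((hf n).mem_left a b hab)
  have hκr : ∀ n a b, f n a b ≠ 0 → κ b = n := fun n a b hab => hκ n b ((hf n).mem_right a b hab)
  set F : (ℕ → Bool) → V → V → ℤ := fun ε a b => if ε (κ a) then f (κ a) a b else 0 with hF
  have hFr : ∀ ε a b, F ε a b = if ε (κ b) then f (κ b) a b else 0 := by
    intro ε a b
    by_cases hab : κ a = κ b
    · simp only [hF, hab]
    · have h1 : f (κ a) a b = 0 := by
        by_contra hne
        exact hab (hκr _ a b hne).symm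
      have h2 : f (κ b) a b = 0 := by
        by_contra hne
        exact hab (hκl _ a b hne)
      simp [hF, h1, h2]
  have hFZ : ∀ ε, F ε ∈ Zsuf1 G := by
    intro ε
    refine ⟨⟨fun u v => ?_, fun u v he => ?_⟩, ⟨1, fun u v => ?_⟩, fun v => ?_⟩
    · rw [hFr ε u v]
      simp only [hF]
      split_ifs
      · exact (hf _).chain.1 u v
      · simp
    · simp only [hF] at he
      split_ifs at he
      · exact (hf _).chain.2 u v he
      · simp at he
    · simp only [hF]
      split_ifs
      · exact hf1 _ u v
      · simp
    · simp only [chainDiv, hFr]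
      split_ifs
      · rw [finsum_eq_sum_of_support_subset (s := S (κ v)) _ fun u hu => (hf _).mem_left u v hu]
        exact (hf _).div_eq_zero v
      · simp
  by_contra! hcon
  have hFcont : Continuous F := by
    refine continuous_pi fun a => continuous_pi fun b => ?_
    exact (continuous_of_discreteTopology (f := fun x : Bool => if x then f (κ a) a b else 0)).comp
      (continuous_apply (κ a))
  obtain ⟨⟨r, K⟩, ε, hε⟩ := nonempty_interior_of_iUnion_of_closed
    (f := fun x : ℕ × ℕ => F ⁻¹' CrBdd G x.1 x.2)
    (fun x => (isClosed_CrBdd h x.1 x.2).preimage hFcont) (by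
      refine Set.eq_univ_of_forall fun ε => ?_
      obtain ⟨r, g, ⟨K, hK⟩, hr, -, hg⟩ := Set.mem_iUnion.1 (hcon _ (hFZ ε))
      exact Set.mem_iUnion.2 ⟨(r, K), g, hK, hr, hg⟩)
  have hlim : Filter.Tendsto (fun n => Function.update ε n (!ε n)) Filter.atTop (nhds ε) := by
    refine tendsto_pi_nhds.2 fun k => tendsto_const_nhds.congr' ?_
    filter_upwards [Filter.eventually_gt_atTop k] with n hn
    rw [Function.update_of_ne hn.ne]
  obtain ⟨n, hn, hnr, hnK⟩ := ((hlim.eventually (isOpen_interior.mem_nhds hε)).and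
    ((Filter.eventually_ge_atTop r).and (Filter.eventually_ge_atTop (K + K)))).exists
  have h1 : ε ∈ F ⁻¹' CrBdd G r K := interior_subset hε
  have h2 : Function.update ε n (!ε n) ∈ F ⁻¹' CrBdd G r K := interior_subset hn
  have hflip : ∀ a b, F (Function.update ε n (!ε n)) a b - F ε a b =
      if ε n then - f n a b else f n a b := by
    intro a b
    by_cases ha : κ a = n
    · simp only [hF, ha, Function.update_self]
      cases ε n <;> simp
    · have : f n a b = 0 := by
        by_contra hne
        exact ha (hκl n a b hne)
      simp [hF, Function.update_of_ne ha, this]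
  refine hfn n (CrBdd_mono hnr hnK ?_)
  cases hεn : ε n with
  | false =>
    convert add_mem_CrBdd h h2 (neg_mem_CrBdd h1) using 1
    funext a b
    have := hflip a b
    rw [if_neg (by simp [hεn])] at this
    simp only [Pi.add_apply, Pi.neg_apply]
    omega
  | true =>
    convert add_mem_CrBdd h h1 (neg_mem_CrBdd h2) using 1
    funext a b
    have := hflip a b
    rw [if_pos hεn] at this
    simp only [Pi.add_apply, Pi.neg_apply]
    omega

end UFH
end

section
/- Let X be a connected uniformly locally finite graph. Then X has H^suf_0-expansion if and only if X is non-amenable. That is: there exists a function K : ℕ → ℕ such that for every finite U ⊆ V(X), every N ∈ ℕ, and every function f : U → ℤ with |f(v)| ≤ N for all v ∈ U, there is a 1-chain g on X with ‖g‖ ≤ K(N) whose divergence at every v ∈ U equals f(v) — if and only if — there exists ε > 0 such that |∂U| ≥ ε·|U| for every finite U ⊆ V(X), where ∂U is the set of edges of X with exactly one endpoint in U. -/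
open scoped Classical

namespace UFH

variable {V : Type}

section Flow

variable {G : SimpleGraph V} {g : V → V → ℤ} {C : ℕ} {S U : Finset V}

theorem IsChain1.neg (hg : IsChain1 G g) : IsChain1 G (-g) :=
  ⟨fun u v => by simp [hg.1 u v], fun u v h => hg.2 u v (by simpa using h)⟩

theorem Bdd.neg (hg : Bdd g C) : Bdd (-g) C := fun u v => by simpa using hg u v

theorem chainDiv_neg (g : V → V → ℤ) (v : V) : chainDiv (-g) v = -chainDiv g v := by
  simp [chainDiv, finsum_neg_distrib]

theorem IsChain1.support_subset (hg : IsChain1 G g) (v : V) :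
    Function.support (fun u => g u v) ⊆ G.neighborSet v :=
  fun u hu => (hg.2 u v hu).symm

/-- The unit chain carrying one unit from `a` to `b`. -/
noncomputable def unitChain (a b : V) : V → V → ℤ := fun x y =>
  (if x = a ∧ y = b then 1 else 0) - (if x = b ∧ y = a then 1 else 0)

theorem isChain1_unitChain {a b : V} (h : G.Adj a b) : IsChain1 G (unitChain a b) := by
  refine ⟨fun u v => ?_, fun u v huv => ?_⟩
  · simp only [unitChain, and_comm, neg_sub]
  · by_cases h1 : u = a ∧ v = b
    · rwa [h1.1, h1.2]
    · by_cases h2 : u = b ∧ v = a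
      · rw [h2.1, h2.2]
        exact h.symm
      · simp [unitChain, h1, h2] at huv

theorem chainDiv_unitChain {a b : V} (h : a ≠ b) (x : V) :
    chainDiv (unitChain a b) x = (if x = b then 1 else 0) - (if x = a then 1 else 0) := by
  unfold chainDiv
  rw [finsum_eq_sum_of_support_subset (s := {a, b})]
  · rw [Finset.sum_pair h]
    by_cases hxa : x = a <;> by_cases hxb : x = b <;> simp [unitChain, hxa, hxb, h, h.symm]
  · intro u hu
    by_contra hn
    simp only [Finset.coe_insert, Finset.coe_singleton, Set.mem_insert_iff,
      Set.mem_singleton_iff, not_or] at hn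
    simp [unitChain, hn.1, hn.2] at hu

theorem IsChain1.add {h : V → V → ℤ} (hg : IsChain1 G g) (hh : IsChain1 G h) :
    IsChain1 G (g + h) := by
  refine ⟨fun u v => ?_, fun u v huv => ?_⟩
  · simp only [Pi.add_apply, hg.1 u v, hh.1 u v]
    ring
  · by_contra hn
    have h1 : g u v = 0 := by_contra fun h' => hn (hg.2 u v h')
    have h2 : h u v = 0 := by_contra fun h' => hn (hh.2 u v h')
    simp [h1, h2] at huv

theorem chainDiv_add (hfin : ∀ v, (G.neighborSet v).Finite) {h : V → V → ℤ}
    (hg : IsChain1 G g) (hh : IsChain1 G h) (v : V) :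
    chainDiv (g + h) v = chainDiv g v + chainDiv h v :=
  finsum_add_distrib ((hfin v).subset (hg.support_subset v))
    ((hfin v).subset (hh.support_subset v))

/-- A nontrivial chain of relations leaving `v` can be started at its last visit to `v`. -/
theorem exists_last_exit {α : Type*} {R : α → α → Prop} {v t : α}
    (h : Relation.ReflTransGen R v t) :
    t = v ∨ ∃ w, R v w ∧ Relation.ReflTransGen (fun x y => R x y ∧ x ≠ v) w t := by
  induction h with
  | refl => exact Or.inl rfl
  | @tail b c _ hbc ih =>
    right
    by_cases hb : b = v
    · exact ⟨c, hb ▸ hbc, .refl⟩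
    · obtain rfl | ⟨w, hw, hwb⟩ := ih
      · exact absurd rfl hb
      · exact ⟨w, hw, hwb.tail ⟨hbc, hb⟩⟩

/-- Augmentation along a residual path from `t` to `v` all of whose vertices, except possibly
`t`, lie in `U`. -/
theorem exists_augmentation (hfin : ∀ v, (G.neighborSet v).Finite) (U : Finset V) :
    ∀ (g : V → V → ℤ) (v t : V), IsChain1 G g → Bdd g C →
      Relation.ReflTransGen (fun x y => x ∈ U ∧ G.Adj x y ∧ g y x < C) v t →
      ∃ g', IsChain1 G g' ∧ Bdd g' C ∧ ∀ x, chainDiv g' x =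
        chainDiv g x + (if x = v then 1 else 0) - (if x = t then 1 else 0) := by
  induction U using Finset.strongInduction with
  | H U ih =>
    intro g v t hg hC h
    obtain rfl | ⟨w, ⟨hvU, hvw, hlt⟩, hwt⟩ := exists_last_exit h
    · exact ⟨g, hg, hC, fun x => by ring⟩
    have hu := isChain1_unitChain hvw.symm
    have hne : w ≠ v := hvw.ne'
    have hanti := hg.1 w v
    obtain ⟨g', hg', hC', hdiv⟩ := ih (U.erase v) (Finset.erase_ssubset hvU)
      (g + unitChain w v) w t (hg.add hu) (by
        intro x y
        have hxy := abs_le.1 (hC x y)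
        rw [abs_le]
        simp only [Pi.add_apply, unitChain]
        split_ifs with h1 h2 h2
        · exact absurd (h1.1.symm.trans h2.1) hne
        · rw [h1.1, h1.2] at hxy ⊢
          omega
        · rw [h2.1, h2.2] at hxy ⊢
          omega
        · omega) (by
        refine Relation.ReflTransGen.mono ?_ _ _ hwt
        rintro x y ⟨⟨hx, hxy, hlt'⟩, hxv⟩
        refine ⟨Finset.mem_erase.2 ⟨hxv, hx⟩, hxy, ?_⟩
        simp only [Pi.add_apply, unitChain, hxv, and_false, if_false]
        split_ifs <;> omega)
    refine ⟨g', hg', hC', fun x => ?_⟩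
    rw [hdiv, chainDiv_add hfin hg hu, chainDiv_unitChain hne]
    ring

/-- The edge boundary of `S`, oriented outwards. -/
noncomputable def orientedBoundary (hfin : ∀ v, (G.neighborSet v).Finite) (S : Finset V) :
    Finset (V × V) :=
  (S ×ˢ (S.biUnion (fun v => (hfin v).toFinset) \ S)).filter fun p => G.Adj p.1 p.2

theorem mem_orientedBoundary (hfin : ∀ v, (G.neighborSet v).Finite) {p : V × V} :
    p ∈ orientedBoundary hfin S ↔ p.1 ∈ S ∧ p.2 ∉ S ∧ G.Adj p.1 p.2 := by
  simp only [orientedBoundary, Finset.mem_filter, Finset.mem_product, Finset.mem_sdiff,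
    Finset.mem_biUnion, Set.Finite.mem_toFinset, SimpleGraph.mem_neighborSet]
  exact ⟨fun h => ⟨h.1.1, h.1.2.2, h.2⟩, fun h => ⟨⟨h.1, ⟨_, h.1, h.2.2⟩, h.2.1⟩, h.2.2⟩⟩

theorem ncard_edgeBoundary (hfin : ∀ v, (G.neighborSet v).Finite) (S : Finset V) :
    (edgeBoundary G S).ncard = (orientedBoundary hfin S).card := by
  rw [← Set.ncard_coe_finset, ← Set.InjOn.ncard_image (f := fun p : V × V => s(p.1, p.2))]
  · congr 1
    ext e
    simp only [edgeBoundary, Set.mem_ofPred_eq, Set.mem_image, Finset.mem_coe,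
      mem_orientedBoundary]
    constructor
    · rintro ⟨he, a, b, rfl, ha, hb⟩
      exact ⟨(a, b), ⟨ha, hb, he⟩, rfl⟩
    · rintro ⟨p, ⟨ha, hb, hp⟩, rfl⟩
      exact ⟨hp, _, _, rfl, ha, hb⟩
  · rintro ⟨a, b⟩ hp ⟨c, d⟩ hq h
    rw [Finset.mem_coe, mem_orientedBoundary] at hp hq
    obtain ⟨rfl, rfl⟩ | ⟨rfl, rfl⟩ := Sym2.eq_iff.1 h
    · rfl
    · exact absurd hp.1 hq.2.1

/-- The divergence theorem for finite sets of vertices. -/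
theorem sum_chainDiv (hfin : ∀ v, (G.neighborSet v).Finite) (hg : IsChain1 G g) (S : Finset V) :
    ∑ x ∈ S, chainDiv g x = ∑ p ∈ orientedBoundary hfin S, g p.2 p.1 := by
  set T := S.biUnion fun v => (hfin v).toFinset
  have hdiv : ∀ x ∈ S, chainDiv g x = ∑ y ∈ S, g y x + ∑ y ∈ T \ S, g y x := by
    intro x hx
    rw [← Finset.sum_union Finset.disjoint_sdiff, Finset.union_sdiff_self_eq_union]
    refine finsum_eq_sum_of_support_subset _ fun y hy => ?_
    exact Finset.mem_coe.2 (Finset.mem_union_right _ (Finset.mem_biUnion.2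
      ⟨x, hx, (hfin x).mem_toFinset.2 (hg.support_subset x hy)⟩))
  have hzero : ∑ x ∈ S, ∑ y ∈ S, g y x = 0 := by
    have h : ∑ x ∈ S, ∑ y ∈ S, g y x = -∑ x ∈ S, ∑ y ∈ S, g y x := by
      conv_lhs => rw [Finset.sum_comm]
      simp only [← Finset.sum_neg_distrib]
      exact Finset.sum_congr rfl fun x _ => Finset.sum_congr rfl fun y _ => hg.1 x y
    omega
  rw [Finset.sum_congr rfl hdiv, Finset.sum_add_distrib, hzero, zero_add, orientedBoundary,
    Finset.sum_filter_of_ne fun p _ hp => (hg.2 _ _ hp).symm, Finset.sum_product]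

/-- A bounded chain whose divergence is too small somewhere on `U` can be improved. -/
theorem exists_improvement (hfin : ∀ v, (G.neighborSet v).Finite) {f : V → ℤ}
    (hcut : ∀ S ⊆ U, ∑ x ∈ S, f x ≤ C * (edgeBoundary G S).ncard)
    (hg : IsChain1 G g) (hC : Bdd g C) {v : V} (hv : v ∈ U) (hlt : chainDiv g v < f v) :
    ∃ g', IsChain1 G g' ∧ Bdd g' C ∧
      ∑ x ∈ U, (f x - chainDiv g' x).natAbs < ∑ x ∈ U, (f x - chainDiv g x).natAbs := by
  set R : V → V → Prop := fun x y => x ∈ U ∧ G.Adj x y ∧ g y x < C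
  by_cases ht : ∃ t, Relation.ReflTransGen R v t ∧ (t ∈ U → f t < chainDiv g t)
  · obtain ⟨t, hvt, ht⟩ := ht
    obtain ⟨g', hg', hC', hdiv⟩ := exists_augmentation hfin U g v t hg hC hvt
    have hne : v ≠ t := by
      rintro rfl
      exact absurd (ht hv) (by omega)
    refine ⟨g', hg', hC', Finset.sum_lt_sum (fun x hx => ?_) ⟨v, hv, ?_⟩⟩
    · rw [hdiv]
      split_ifs with h1 h2 h2
      · exact absurd (h1.symm.trans h2) hne
      · subst h1
        omega
      · subst h2
        have := ht hx
        omega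
      · omega
    · rw [hdiv, if_pos rfl, if_neg hne]
      omega
  · push Not at ht
    set S := U.filter fun x => Relation.ReflTransGen R v x
    have hmem : ∀ x, x ∈ S ↔ Relation.ReflTransGen R v x := fun x => by
      simp only [S, Finset.mem_filter, and_iff_right_iff_imp]
      exact fun h => (ht x h).1
    have h1 : ∑ x ∈ S, chainDiv g x < ∑ x ∈ S, f x :=
      Finset.sum_lt_sum (fun x hx => (ht x ((hmem x).1 hx)).2) ⟨v, (hmem v).2 .refl, hlt⟩
    have h2 : (C : ℤ) * (edgeBoundary G S).ncard ≤ ∑ x ∈ S, chainDiv g x := by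
      rw [sum_chainDiv hfin hg, ncard_edgeBoundary hfin, mul_comm, ← nsmul_eq_mul]
      refine Finset.card_nsmul_le_sum _ _ _ fun p hp => ?_
      obtain ⟨hp1, hp2, hp3⟩ := (mem_orientedBoundary hfin).1 hp
      by_contra hcon
      have hstep : R p.1 p.2 := ⟨(Finset.mem_filter.1 hp1).1, hp3, not_le.1 hcon⟩
      exact hp2 ((hmem _).2 (((hmem _).1 hp1).tail hstep))
    exact absurd (hcut S (Finset.filter_subset _ _)) (by omega)

/-- Integral flows with prescribed divergence on `U` exist as soon as every cut inside `U` has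
sufficient capacity. -/
theorem exists_chain_of_cut (hfin : ∀ v, (G.neighborSet v).Finite) {f : V → ℤ}
    (hcut : ∀ S ⊆ U, |∑ x ∈ S, f x| ≤ C * (edgeBoundary G S).ncard) :
    ∃ g, IsChain1 G g ∧ Bdd g C ∧ ∀ v ∈ U, chainDiv g v = f v := by
  let gap : {g : V → V → ℤ // IsChain1 G g ∧ Bdd g C} → ℕ :=
    fun g => ∑ x ∈ U, (f x - chainDiv g.1 x).natAbs
  have : Nonempty {g : V → V → ℤ // IsChain1 G g ∧ Bdd g C} :=
    ⟨⟨0, ⟨by simp, by simp⟩, fun _ _ => by simp⟩⟩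
  set m := Function.argmin gap
  have hmin : ∀ g', IsChain1 G g' → Bdd g' C →
      ∑ x ∈ U, (f x - chainDiv m.1 x).natAbs ≤ ∑ x ∈ U, (f x - chainDiv g' x).natAbs :=
    fun g' h1 h2 => Function.argmin_le gap ⟨g', h1, h2⟩
  refine ⟨m.1, m.2.1, m.2.2, fun v hv => ?_⟩
  obtain h | h | h := lt_trichotomy (chainDiv m.1 v) (f v)
  · obtain ⟨g', h1, h2, h3⟩ := exists_improvement hfin
      (fun S hS => (le_abs_self _).trans (hcut S hS)) m.2.1 m.2.2 hv h
    exact absurd (hmin g' h1 h2) (not_le.2 h3)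
  · exact h
  · obtain ⟨g', h1, h2, h3⟩ := exists_improvement (f := -f) hfin
      (fun S hS => by simpa using (neg_le_abs _).trans (hcut S hS)) m.2.1.neg m.2.2.neg hv
      (by simpa [chainDiv_neg] using h)
    have hneg : ∀ h : V → V → ℤ, ∑ x ∈ U, ((-f) x - chainDiv (-h) x).natAbs =
        ∑ x ∈ U, (f x - chainDiv h x).natAbs := fun h =>
      Finset.sum_congr rfl fun x _ => by
        rw [chainDiv_neg, Pi.neg_apply]
        omega
    have h4 := hneg (-g')
    rw [neg_neg] at h4
    rw [h4, hneg] at h3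
    exact absurd (hmin _ h1.neg h2.neg) (not_le.2 h3)

end Flow

/-- H^suf_0-expansion is equivalent to non-amenability. -/
theorem stmt15 (G : SimpleGraph V) (hulf : ULF G) (hconn : G.Connected) :
    (∃ K : ℕ → ℕ, ∀ U : Finset V, ∀ N : ℕ, ∀ fv : V → ℤ,
        (∀ v ∈ U, |fv v| ≤ (N : ℤ)) →
        ∃ g : V → V → ℤ, IsChain1 G g ∧ Bdd g (K N) ∧ ∀ v ∈ U, chainDiv g v = fv v) ↔
    (∃ ε : ℝ, 0 < ε ∧ ∀ U : Finset V, ε * (U.card : ℝ) ≤ ((edgeBoundary G U).ncard : ℝ)) := by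
  obtain ⟨D, hD⟩ := hulf
  have hfin : ∀ v, (G.neighborSet v).Finite := fun v => (hD v).1
  constructor
  · rintro ⟨K, hK⟩
    refine ⟨1 / (K 1 + 1), by positivity, fun U => ?_⟩
    obtain ⟨g, hg, hC, hdiv⟩ := hK U 1 1 (by simp)
    have h : (U.card : ℤ) ≤ (edgeBoundary G U).ncard * K 1 := by
      calc (U.card : ℤ) = ∑ x ∈ U, chainDiv g x := by
            rw [Finset.sum_congr rfl hdiv]
            simp
        _ = ∑ p ∈ orientedBoundary hfin U, g p.2 p.1 := sum_chainDiv hfin hg U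
        _ ≤ (orientedBoundary hfin U).card • (K 1 : ℤ) :=
            Finset.sum_le_card_nsmul _ _ _ fun p _ => (le_abs_self _).trans (hC _ _)
        _ = _ := by rw [ncard_edgeBoundary hfin, nsmul_eq_mul]
    have h' : (U.card : ℝ) ≤ (edgeBoundary G U).ncard * K 1 := by exact_mod_cast h
    rw [one_div_mul_eq_div, div_le_iff₀ (by positivity)]
    nlinarith [Nat.cast_nonneg (α := ℝ) (edgeBoundary G U).ncard]
  · rintro ⟨ε, hε, hG⟩
    refine ⟨fun N => ⌈N / ε⌉₊, fun U N f hf => exists_chain_of_cut hfin fun S hS => ?_⟩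
    have h1 : |∑ x ∈ S, f x| ≤ S.card * N := by
      rw [← nsmul_eq_mul]
      exact (Finset.abs_sum_le_sum_abs _ _).trans
        (Finset.sum_le_card_nsmul _ _ _ fun x hx => hf x (hS hx))
    have h2 : (S.card : ℝ) * N ≤ ⌈N / ε⌉₊ * (edgeBoundary G S).ncard := by
      calc (S.card : ℝ) * N = N / ε * (ε * S.card) := by field_simp
        _ ≤ ⌈N / ε⌉₊ * (edgeBoundary G S).ncard :=
            mul_le_mul (Nat.le_ceil _) (hG S) (by positivity) (by positivity)
    exact h1.trans (by exact_mod_cast h2)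

end UFH
end

section
/- Let X be a connected uniformly locally finite graph, with 2-simplices its triangles. If X has H^suf_1-expansion, then every element of Z^suf_1(X,ℤ) is the boundary of a bounded 2-chain; i.e., H^suf_1(X,ℤ) = 0. -/
open scoped Classical

namespace UFH

variable {V : Type}

/-- A uniformly bounded family of integer-valued functions indexed by a directed order has a
pointwise cluster point, which agrees with arbitrarily late members of the family on any
finite set. -/
theorem exists_cluster_of_bounded {ι α : Type*} [Preorder ι] [IsDirectedOrder ι] [Nonempty ι]
    (F : ι → α → ℤ) (C : ℤ) (hF : ∀ i a, |F i a| ≤ C) :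
    ∃ g : α → ℤ, ∀ S : Set α, S.Finite → ∀ i₀, ∃ i, i₀ ≤ i ∧ ∀ a ∈ S, g a = F i a := by
  let 𝓤 : Ultrafilter ι := Ultrafilter.of Filter.atTop
  have hlim : ∀ a, ∃ z : ℤ, ∀ᶠ i in (𝓤 : Filter ι), z = F i a := by
    intro a
    have h : ∀ᶠ i in (𝓤 : Filter ι), ∃ z ∈ Set.Icc (-C) C, z = F i a :=
      Filter.Eventually.of_forall fun i => ⟨F i a, abs_le.mp (hF i a), rfl⟩
    obtain ⟨z, -, hz⟩ := (Ultrafilter.eventually_exists_mem_iff (Set.finite_Icc (-C) C)).mp h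
    exact ⟨z, hz⟩
  choose g hg using hlim
  refine ⟨g, fun S hS i₀ => ?_⟩
  have h₁ : ∀ᶠ i in (𝓤 : Filter ι), i₀ ≤ i :=
    (Ultrafilter.of_le Filter.atTop) (Filter.eventually_ge_atTop i₀)
  have h₂ : ∀ᶠ i in (𝓤 : Filter ι), ∀ a ∈ S, g a = F i a :=
    (Filter.eventually_all_finite hS).mpr fun a _ => hg a
  exact (h₁.and h₂).exists

/-- The restriction of a 1-chain to the edges with both endpoints in `U`. -/
noncomputable def restrict (U : Finset V) (f : V → V → ℤ) : V → V → ℤ :=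
  fun u v => if u ∈ U ∧ v ∈ U then f u v else 0

theorem restrict_apply {U : Finset V} {f : V → V → ℤ} {u v : V} (hu : u ∈ U) (hv : v ∈ U) :
    restrict U f u v = f u v := if_pos ⟨hu, hv⟩

theorem mem_of_restrict_ne_zero {U : Finset V} {f : V → V → ℤ} {u v : V}
    (h : restrict U f u v ≠ 0) : u ∈ U ∧ v ∈ U := by
  by_contra hn
  exact h (if_neg hn)

theorem isChain1_restrict {G : SimpleGraph V} {f : V → V → ℤ} (hf : IsChain1 G f)
    (U : Finset V) : IsChain1 G (restrict U f) := by
  refine ⟨fun u v => ?_, fun u v h => ?_⟩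
  · have := hf.1 u v
    unfold restrict
    split_ifs <;> simp_all
  · obtain ⟨hu, hv⟩ := mem_of_restrict_ne_zero h
    rw [restrict_apply hu hv] at h
    exact hf.2 u v h

theorem chainDiv_restrict {G : SimpleGraph V} {f : V → V → ℤ} (hf : IsChain1 G f)
    {U : Finset V} {v : V} (hv : v ∈ U) (hU : ∀ u, G.Adj u v → u ∈ U) :
    chainDiv (restrict U f) v = chainDiv f v := by
  refine finsum_congr fun u => ?_
  by_cases hu : u ∈ U
  · exact restrict_apply hu hv
  · have h0 : f u v = 0 := by
      by_contra h
      exact hu (hU u (hf.2 u v h))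
    rw [h0]
    exact if_neg fun h => hu h.1

theorem bdd_chainNorm {f : V → V → ℤ} (hf : ∃ C, Bdd f C) : Bdd f (chainNorm f) :=
  Nat.sInf_mem hf

theorem chainNorm_le {f : V → V → ℤ} {C : ℕ} (hf : Bdd f C) : chainNorm f ≤ C :=
  Nat.sInf_le hf

theorem bdd_restrict {f : V → V → ℤ} {C : ℕ} (hf : Bdd f C) (U : Finset V) :
    Bdd (restrict U f) C := by
  intro u v
  unfold restrict
  split_ifs
  · exact hf u v
  · simp

/-- The sup-norm of a bounded chain is already attained on some finite set of vertices. -/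
theorem exists_chainNorm_restrict {f : V → V → ℤ} (hf : ∃ C, Bdd f C) :
    ∃ U₀ : Finset V, ∀ U, U₀ ⊆ U → chainNorm (restrict U f) = chainNorm f := by
  have hle : ∀ U, chainNorm (restrict U f) ≤ chainNorm f := fun U =>
    chainNorm_le (bdd_restrict (bdd_chainNorm hf) U)
  obtain h0 | hpos := Nat.eq_zero_or_pos (chainNorm f)
  · exact ⟨∅, fun U _ => le_antisymm (hle U) (h0 ▸ Nat.zero_le _)⟩
  have hnot : ¬ Bdd f (chainNorm f - 1) := fun h => by
    have := chainNorm_le h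
    omega
  simp only [Bdd, not_forall, not_le] at hnot
  obtain ⟨a, b, hab⟩ := hnot
  refine ⟨{a, b}, fun U hU => le_antisymm (hle U) ?_⟩
  have h := bdd_chainNorm ⟨_, bdd_restrict (bdd_chainNorm hf) U⟩ a b
  rw [restrict_apply (hU (by simp)) (hU (by simp))] at h
  omega

/-- H^suf_1-expansion implies vanishing of H^suf_1(X,ℤ). -/
theorem stmt16 (G : SimpleGraph V) (hulf : ULF G) (hconn : G.Connected)
    (hexp : HsufExp1 G) :
    ∀ f ∈ Zsuf1 G, ∃ g : V → V → V → ℤ, IsChain2 G g ∧ (∃ C, Bdd2 g C) ∧ bd2 g = f := by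
  intro f hf
  obtain ⟨hchain, hbdd, hdiv⟩ := id hf
  obtain ⟨K, hK⟩ := hexp
  obtain ⟨D, hD⟩ := hulf
  obtain ⟨U₀, hU₀⟩ := exists_chainNorm_restrict hbdd
  have hlocal : ∀ U : Finset V, ∃ g : V → V → V → ℤ, IsChain2 G g ∧
      Bdd2 g (K (chainNorm f)) ∧ ∀ u ∈ U, ∀ v ∈ U, bd2 g u v = f u v := by
    intro U
    have hnorm := hU₀ (U ∪ U₀) Finset.subset_union_right
    obtain ⟨g, hg, hgb, hgf⟩ := hK (U ∪ U₀) (restrict (U ∪ U₀) f)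
      (isChain1_restrict hchain _) (fun u v => mem_of_restrict_ne_zero)
      (fun v hv hU => (chainDiv_restrict hchain hv hU).trans (hdiv v))
      ⟨f, hf, fun u hu v hv => (restrict_apply hu hv).symm, hnorm.symm⟩
    refine ⟨g, hg, hnorm ▸ hgb, fun u hu v hv => ?_⟩
    have hu' := Finset.mem_union_left U₀ hu
    have hv' := Finset.mem_union_left U₀ hv
    rw [hgf u hu' v hv', restrict_apply hu' hv']
  choose g hg hgb hgf using hlocal
  obtain ⟨γ, hγ⟩ := exists_cluster_of_bounded
    (fun (U : Finset V) (t : V × V × V) => g U t.1 t.2.1 t.2.2) (K (chainNorm f))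
    fun U t => hgb U t.1 t.2.1 t.2.2
  have hsupp : ∀ u v w, γ (u, v, w) ≠ 0 → G.Adj u v ∧ G.Adj v w ∧ G.Adj u w := by
    intro u v w h
    obtain ⟨U, -, hU⟩ := hγ {(u, v, w)} (Set.finite_singleton _) ∅
    exact (hg U).2.2 u v w (hU _ rfl ▸ h)
  refine ⟨fun u v w => γ (u, v, w), ⟨fun u v w => ?_, fun u v w => ?_, hsupp⟩,
    ⟨K (chainNorm f), fun u v w => ?_⟩, ?_⟩
  · obtain ⟨U, -, hU⟩ := hγ {(u, v, w), (v, u, w)} (Set.toFinite _) ∅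
    simpa [hU (u, v, w) (by simp), hU (v, u, w) (by simp)] using (hg U).1 u v w
  · obtain ⟨U, -, hU⟩ := hγ {(u, v, w), (u, w, v)} (Set.toFinite _) ∅
    simpa [hU (u, v, w) (by simp), hU (u, w, v) (by simp)] using (hg U).2.1 u v w
  · obtain ⟨U, -, hU⟩ := hγ {(u, v, w)} (Set.finite_singleton _) ∅
    simpa [hU (u, v, w) rfl] using hgb U u v w
  · funext u v
    obtain ⟨U, hUle, hU⟩ := hγ ((fun w => (u, v, w)) '' G.neighborSet u)
      ((hD u).1.image _) {u, v}
    rw [← hgf U u (hUle (by simp)) v (hUle (by simp))]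
    refine finsum_congr fun w => ?_
    by_cases hw : G.Adj u w
    · exact hU _ ⟨w, hw, rfl⟩
    · have h₁ : γ (u, v, w) = 0 := by
        by_contra h
        exact hw (hsupp u v w h).2.2
      have h₂ : g U u v w = 0 := by
        by_contra h
        exact hw ((hg U).2.2 u v w h).2.2
      exact h₁.trans h₂.symm

end UFH
end
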